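/- Let (r_U, r_W, a, b) be natural numbers. There exists an isotropic subspace S of V with dim(S ∩ U) = r_U, dim(S ∩ W) = r_W, dim Rad(proj_U S) = r_U + a, dim proj_U S = r_U + a + b, and dim S = r_U + r_W + a + b if and only if b is even, 2·r_U + 2·a + b ≤ dim U, and 2·r_W + 2·a + b ≤ dim W. -/

import Mathlib

open Module

/-- The projection of `S` onto `A` along the complement `C`: `(S + C) ⊓ A`. -/
def projAlong {k V : Type*} [Field k] [AddCommGroup V] [Module k V]
    (C A S : Submodule k V) : Submodule k V := (S ⊔ C) ⊓ A

/-- The radical of `T` with respect to `B`: `T ⊓ T^⊥`. -/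
def bilinRad {k V : Type*} [Field k] [AddCommGroup V] [Module k V]
    (B : LinearMap.BilinForm k V) (T : Submodule k V) : Submodule k V :=
  T ⊓ B.orthogonal T

section Projections

variable {k V : Type*} [Field k] [AddCommGroup V] [Module k V]

theorem mem_projAlong {C A S : Submodule k V} {u : V} :
    u ∈ projAlong C A S ↔ u ∈ A ∧ ∃ w ∈ C, u + w ∈ S := by
  constructor
  · rintro ⟨h, hu⟩
    obtain ⟨s, hs, w, hw, rfl⟩ := Submodule.mem_sup.mp h
    exact ⟨hu, -w, C.neg_mem hw, by simpa using hs⟩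
  · rintro ⟨hu, w, hw, hs⟩
    exact ⟨Submodule.mem_sup.mpr ⟨u + w, hs, -w, C.neg_mem hw, by simp⟩, hu⟩

theorem finrank_projAlong_add_finrank_inf [FiniteDimensional k V] {U W : Submodule k V}
    (hinf : U ⊓ W = ⊥) (hsup : U ⊔ W = ⊤) (S : Submodule k V) :
    finrank k (projAlong W U S) + finrank k (S ⊓ W : Submodule k V) = finrank k S := by
  have hPW : projAlong W U S ⊓ W = ⊥ := by
    rw [projAlong, inf_assoc, hinf, inf_bot_eq]
  have hPsup : projAlong W U S ⊔ W = S ⊔ W := by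
    rw [projAlong, inf_sup_assoc_of_le U le_sup_right, hsup, inf_top_eq]
  have h₁ := Submodule.finrank_sup_add_finrank_inf_eq (projAlong W U S) W
  have h₂ := Submodule.finrank_sup_add_finrank_inf_eq S W
  rw [hPW, hPsup, finrank_bot] at h₁
  omega

theorem finrank_add_finrank_bilinRad_le [FiniteDimensional k V] {B : LinearMap.BilinForm k V}
    (hB : B.Nondegenerate) {U W P : Submodule k V} (hinf : U ⊓ W = ⊥) (hsup : U ⊔ W = ⊤)
    (horth : ∀ u ∈ U, ∀ w ∈ W, B u w = 0) (hP : P ≤ U) :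
    finrank k P + finrank k (bilinRad B P) ≤ finrank k U := by
  have hle : bilinRad B P ⊔ W ≤ B.orthogonal P :=
    sup_le inf_le_right fun w hw p hp => horth p (hP hp) w hw
  have hbot : bilinRad B P ⊓ W = ⊥ :=
    le_bot_iff.mp <| hinf ▸ inf_le_inf_right W (inf_le_left.trans hP)
  have h₁ := Submodule.finrank_sup_add_finrank_inf_eq (bilinRad B P) W
  have h₂ := Submodule.finrank_sup_add_finrank_inf_eq U W
  have h₃ := Submodule.finrank_mono hle
  have h₄ := LinearMap.BilinForm.finrank_orthogonal hB P
  have h₅ := Submodule.finrank_le P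
  rw [hbot, finrank_bot] at h₁
  rw [hinf, hsup, finrank_bot, finrank_top] at h₂
  omega

/-- Elements of an isotropic subspace are orthogonal to one projection exactly when they are
orthogonal to the other. -/
theorem inf_orthogonal_projAlong_le {B : LinearMap.BilinForm k V} {U W S : Submodule k V}
    (hS : ∀ s ∈ S, ∀ s' ∈ S, B s s' = 0) :
    S ⊓ B.orthogonal (projAlong W U S) ≤ S ⊓ B.orthogonal (projAlong U W S) := by
  rintro s ⟨hs, hs'⟩
  refine ⟨hs, fun q hq => ?_⟩
  obtain ⟨hqW, p, hp, hqp⟩ := mem_projAlong.mp hq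
  have h₁ : B p s = 0 := hs' p (mem_projAlong.mpr ⟨hp, q, hqW, add_comm q p ▸ hqp⟩)
  have h₂ := hS _ hqp s hs
  rw [map_add, LinearMap.add_apply, h₁, add_zero] at h₂
  exact h₂

theorem bilinRad_projAlong {B : LinearMap.BilinForm k V} {U W S : Submodule k V}
    (horth : ∀ u ∈ U, ∀ w ∈ W, B u w = 0) :
    bilinRad B (projAlong W U S) =
      projAlong W U (S ⊓ B.orthogonal (projAlong W U S)) := by
  have key : ∀ u, ∀ w ∈ W, ∀ p ∈ projAlong W U S, B p (u + w) = B p u := fun u w hw p hp => by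
    rw [map_add, horth p (mem_projAlong.mp hp).1 w hw, add_zero]
  ext u
  rw [mem_projAlong]
  constructor
  · rintro ⟨hu, hu'⟩
    obtain ⟨huU, w, hw, hs⟩ := mem_projAlong.mp hu
    exact ⟨huU, w, hw, hs, fun p hp => (key u w hw p hp).trans (hu' p hp)⟩
  · rintro ⟨huU, w, hw, hs, hs'⟩
    exact ⟨mem_projAlong.mpr ⟨huU, w, hw, hs⟩,
      fun p hp => (key u w hw p hp).symm.trans (hs' p hp)⟩

theorem inf_orthogonal_projAlong_inf {B : LinearMap.BilinForm k V} {U W S : Submodule k V}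
    (horth : ∀ u ∈ U, ∀ w ∈ W, B u w = 0) :
    S ⊓ B.orthogonal (projAlong W U S) ⊓ W = S ⊓ W :=
  le_antisymm (inf_le_inf_right W inf_le_left) fun w hw =>
    ⟨⟨hw.1, fun p hp => horth p (mem_projAlong.mp hp).1 w hw.2⟩, hw.2⟩

theorem finrank_bilinRad_projAlong_add [FiniteDimensional k V] {B : LinearMap.BilinForm k V}
    {U W S : Submodule k V} (hinf : U ⊓ W = ⊥) (hsup : U ⊔ W = ⊤)
    (horth : ∀ u ∈ U, ∀ w ∈ W, B u w = 0) :
    finrank k (bilinRad B (projAlong W U S)) + finrank k (S ⊓ W : Submodule k V) =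
      finrank k (S ⊓ B.orthogonal (projAlong W U S) : Submodule k V) := by
  rw [bilinRad_projAlong horth, ← inf_orthogonal_projAlong_inf (S := S) horth]
  exact finrank_projAlong_add_finrank_inf hinf hsup _

theorem projAlong_range_add {M : Type*} [AddCommGroup M] [Module k M] {U W : Submodule k V}
    (hinf : U ⊓ W = ⊥) {p q : M →ₗ[k] V} (hp : ∀ x, p x ∈ U) (hq : ∀ x, q x ∈ W) :
    projAlong W U (p + q).range = p.range := by
  ext u
  rw [mem_projAlong]
  constructor
  · rintro ⟨hu, w, hw, x, hx⟩
    have heq : u - p x = q x - w := by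
      rw [LinearMap.add_apply] at hx
      rw [sub_eq_sub_iff_add_eq_add, ← hx, add_comm]
    have hmem : u - p x ∈ U ⊓ W :=
      ⟨U.sub_mem hu (hp x), heq ▸ W.sub_mem (hq x) hw⟩
    rw [hinf, Submodule.mem_bot, sub_eq_zero] at hmem
    exact ⟨x, hmem.symm⟩
  · rintro ⟨x, rfl⟩
    exact ⟨hp x, q x, hq x, x, rfl⟩

end Projections

section Symplectic

variable {k V : Type*} [Field k] [AddCommGroup V] [Module k V] [FiniteDimensional k V]

/-- Splitting off a hyperbolic plane. -/
theorem exists_hyperbolic_pair {B : LinearMap.BilinForm k V} (hB : B.IsAlt) {U : Submodule k V}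
    (hU : ∀ x ∈ U, (∀ y ∈ U, B x y = 0) → x = 0) (hpos : 0 < finrank k U) :
    ∃ e ∈ U, ∃ f ∈ U, B e f = 1 ∧ ∃ U' ≤ U, (∀ x ∈ U', B e x = 0 ∧ B f x = 0) ∧
      (∀ x ∈ U', (∀ y ∈ U', B x y = 0) → x = 0) ∧ finrank k U' + 2 = finrank k U := by
  obtain ⟨⟨e, he⟩, hne⟩ := finrank_pos_iff_exists_ne_zero.mp hpos
  have hne' : e ≠ 0 := fun h => hne (Subtype.ext h)
  obtain ⟨y, hy, hey⟩ : ∃ y ∈ U, B e y ≠ 0 := by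
    by_contra! h
    exact hne' (hU e he h)
  obtain ⟨f, hf, hef⟩ : ∃ f ∈ U, B e f = 1 :=
    ⟨(B e y)⁻¹ • y, U.smul_mem _ hy, by simp [hey]⟩
  have hfe : B f e = -1 := by rw [← hB.neg_eq, hef]
  have hee : B e e = 0 := hB e
  have hff : B f f = 0 := hB f
  let φ : U →ₗ[k] k × k := ((B e).prod (B f)).domRestrict U
  have hφ : Function.Surjective φ := fun c =>
    ⟨⟨c.1 • f - c.2 • e, U.sub_mem (U.smul_mem _ hf) (U.smul_mem _ he)⟩, by
      ext <;> simp [φ, hef, hfe, hee, hff]⟩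
  have mem : ∀ x, x ∈ φ.ker.map U.subtype ↔ x ∈ U ∧ B e x = 0 ∧ B f x = 0 := by
    intro x
    simp [φ, and_left_comm]
  refine ⟨e, he, f, hf, hef, φ.ker.map U.subtype, fun x hx => ((mem x).mp hx).1,
    fun x hx => ((mem x).mp hx).2, fun x hx h => ?_, ?_⟩
  · obtain ⟨hxU, hex, hfx⟩ := (mem x).mp hx
    refine hU x hxU fun u hu => ?_
    have := h (u - B e u • f + B f u • e) <| (mem _).mpr
      ⟨U.add_mem (U.sub_mem hu (U.smul_mem _ hf)) (U.smul_mem _ he), by simp [hef, hee],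
        by simp [hfe, hff]⟩
    have hxe : B x e = 0 := by rw [← hB.neg_eq, hex, neg_zero]
    have hxf : B x f = 0 := by rw [← hB.neg_eq, hfx, neg_zero]
    simpa [hxe, hxf] using this
  · rw [Submodule.finrank_map_subtype_eq]
    have := φ.finrank_range_add_finrank_ker
    rw [LinearMap.range_eq_top.mpr hφ, finrank_top, finrank_prod, finrank_self] at this
    omega

theorem even_finrank_of_isAlt {B : LinearMap.BilinForm k V} (hB : B.IsAlt) {U : Submodule k V}
    (hU : ∀ x ∈ U, (∀ y ∈ U, B x y = 0) → x = 0) : Even (finrank k U) := by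
  induction hn : finrank k U using Nat.strong_induction_on generalizing U with
  | _ n ih =>
    rcases Nat.eq_zero_or_pos n with rfl | hpos
    · exact Even.zero
    obtain ⟨-, -, -, -, -, U', -, -, hU', hdim⟩ := exists_hyperbolic_pair hB hU (hn ▸ hpos)
    have := ih (finrank k U') (by omega) hU' rfl
    rw [← hn, ← hdim]
    exact this.add even_two

theorem even_of_finrank_eq_finrank_bilinRad_add {B : LinearMap.BilinForm k V} (hB : B.IsAlt)
    {P : Submodule k V} {b : ℕ} (h : finrank k P = finrank k (bilinRad B P) + b) : Even b := by
  obtain ⟨C, hC⟩ := (bilinRad B P).exists_isCompl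
  have hRP : bilinRad B P ≤ P := inf_le_left
  have hsup : bilinRad B P ⊔ C ⊓ P = P := by
    rw [← sup_inf_assoc_of_le C hRP, hC.sup_eq_top, top_inf_eq]
  have hinf : bilinRad B P ⊓ (C ⊓ P) = ⊥ := by
    rw [← inf_assoc, hC.inf_eq_bot, bot_inf_eq]
  have hdim := Submodule.finrank_sup_add_finrank_inf_eq (bilinRad B P) (C ⊓ P)
  rw [hsup, hinf, finrank_bot, h] at hdim
  obtain rfl : b = finrank k (C ⊓ P : Submodule k V) := by omega
  refine even_finrank_of_isAlt hB fun x hx hx' => ?_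
  have hxR : x ∈ bilinRad B P := by
    refine ⟨hx.2, fun p hp => ?_⟩
    rw [← hsup] at hp
    obtain ⟨r, hr, c, hc, rfl⟩ := Submodule.mem_sup.mp hp
    have hcx : B c x = 0 := by rw [← hB.neg_eq, hx' c hc, neg_zero]
    have hrx : B r x = 0 := by rw [← hB.neg_eq, hr.2 x hx.2, neg_zero]
    change B (r + c) x = 0
    rw [map_add, LinearMap.add_apply, hcx, hrx, add_zero]
  have : x ∈ bilinRad B P ⊓ (C ⊓ P) := ⟨hxR, hx⟩
  rwa [hinf, Submodule.mem_bot] at this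

theorem exists_symplectic_family {B : LinearMap.BilinForm k V} (hB : B.IsAlt) {U : Submodule k V}
    (hU : ∀ x ∈ U, (∀ y ∈ U, B x y = 0) → x = 0) (n : ℕ) (hn : 2 * n ≤ finrank k U) :
    ∃ e f : Fin n → V, (∀ i, e i ∈ U) ∧ (∀ i, f i ∈ U) ∧ (∀ i j, B (e i) (e j) = 0) ∧
      (∀ i j, B (f i) (f j) = 0) ∧ ∀ i j, B (e i) (f j) = if i = j then 1 else 0 := by
  induction n generalizing U with
  | zero => exact ⟨Fin.elim0, Fin.elim0, by simp⟩
  | succ n ih =>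
    obtain ⟨e₀, he₀, f₀, hf₀, hef₀, U', hle, hperp, hU', hdim⟩ :=
      exists_hyperbolic_pair hB hU (by omega)
    obtain ⟨e, f, he, hf, hee, hff, hef⟩ := ih hU' (by omega)
    have hperp' : ∀ x ∈ U', B x e₀ = 0 ∧ B x f₀ = 0 := fun x hx =>
      ⟨by rw [← hB.neg_eq, (hperp x hx).1, neg_zero], by rw [← hB.neg_eq, (hperp x hx).2, neg_zero]⟩
    refine ⟨Fin.cons e₀ e, Fin.cons f₀ f, ?_, ?_, ?_, ?_, ?_⟩
    · exact Fin.cases he₀ fun i => hle (he i)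
    · exact Fin.cases hf₀ fun i => hle (hf i)
    · refine Fin.cases (Fin.cases (hB e₀) fun j => (hperp _ (he j)).1) fun i =>
        Fin.cases (hperp' _ (he i)).1 (hee i)
    · refine Fin.cases (Fin.cases (hB f₀) fun j => (hperp _ (hf j)).2) fun i =>
        Fin.cases (hperp' _ (hf i)).2 (hff i)
    · refine Fin.cases (Fin.cases (by simpa using hef₀) fun j => ?_) fun i =>
        Fin.cases ?_ fun j => ?_
      · simpa [(Fin.succ_ne_zero j).symm] using (hperp _ (hf j)).1
      · simpa using (hperp' _ (he i)).2
      · simpa using hef i j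

theorem exists_symplectic_embedding {B : LinearMap.BilinForm k V} (hB : B.IsAlt)
    {U : Submodule k V} (hU : ∀ x ∈ U, (∀ y ∈ U, B x y = 0) → x = 0) (ι : Type*) [Fintype ι]
    (hι : 2 * Fintype.card ι ≤ finrank k U) :
    ∃ E : (ι → k) × (ι → k) →ₗ[k] V, Function.Injective E ∧ (∀ x, E x ∈ U) ∧
      ∀ x y, B (E x) (E y) = x.1 ⬝ᵥ y.2 - x.2 ⬝ᵥ y.1 := by
  classical
  obtain ⟨e, f, he, hf, hee, hff, hef⟩ := exists_symplectic_family hB hU _ hι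
  have hfe : ∀ i j, B (f i) (e j) = if i = j then -1 else 0 := fun i j => by
    rw [← hB.neg_eq, hef]
    split_ifs with h₁ h₂ h₂ <;> simp_all
  let σ := Fintype.equivFin ι
  let E := (Fintype.linearCombination k (e ∘ σ)).coprod (Fintype.linearCombination k (f ∘ σ))
  have hE : ∀ x y, B (E x) (E y) = x.1 ⬝ᵥ y.2 - x.2 ⬝ᵥ y.1 := fun x y => by
    simp [E, Fintype.linearCombination_apply, hee, hff, hef, hfe, dotProduct,
      sub_eq_add_neg, add_comm, mul_comm]
  refine ⟨E, ?_, fun x => ?_, hE⟩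
  · rw [injective_iff_map_eq_zero]
    intro x hx
    have h : ∀ y : (ι → k) × (ι → k), x.1 ⬝ᵥ y.2 - x.2 ⬝ᵥ y.1 = 0 := fun y => by rw [← hE, hx]; simp
    ext i
    · simpa using h (0, Pi.single i 1)
    · simpa using h (Pi.single i 1, 0)
  · simp only [E, LinearMap.coprod_apply, Fintype.linearCombination_apply]
    exact U.add_mem (U.sum_mem fun i _ => U.smul_mem _ (he _))
      (U.sum_mem fun i _ => U.smul_mem _ (hf _))

/-- A nondegenerate `U` of large enough dimension contains a subspace with radical of dimension
`r + a` and symplectic quotient of dimension `2 * m`. -/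
theorem exists_presymplectic_embedding {B : LinearMap.BilinForm k V} (hB : B.IsAlt)
    {U : Submodule k V} (hU : ∀ x ∈ U, (∀ y ∈ U, B x y = 0) → x = 0) (r a m : ℕ)
    (h : 2 * (r + a + m) ≤ finrank k U) :
    ∃ p : (Fin r → k) × (Fin a → k) × (Fin m → k) × (Fin m → k) →ₗ[k] V,
      Function.Injective p ∧ (∀ x, p x ∈ U) ∧
      ∀ x y, B (p x) (p y) = x.2.2.1 ⬝ᵥ y.2.2.2 - x.2.2.2 ⬝ᵥ y.2.2.1 := by
  obtain ⟨E, hinj, hmem, hE⟩ := exists_symplectic_embedding hB hU (Fin r ⊕ Fin a ⊕ Fin m)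
    (by simpa [add_assoc] using h)
  let j : (Fin r → k) × (Fin a → k) × (Fin m → k) × (Fin m → k) →ₗ[k]
      (Fin r ⊕ Fin a ⊕ Fin m → k) × (Fin r ⊕ Fin a ⊕ Fin m → k) :=
    { toFun := fun x => (Sum.elim x.1 (Sum.elim x.2.1 x.2.2.1), Sum.elim 0 (Sum.elim 0 x.2.2.2))
      map_add' := fun x y => by
        ext (i | i | i) <;> simp
      map_smul' := fun c x => by
        ext (i | i | i) <;> simp }
  refine ⟨E ∘ₗ j, hinj.comp ?_, fun x => hmem _, fun x y => ?_⟩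
  · rintro ⟨x₁, x₂, x₃, x₄⟩ ⟨y₁, y₂, y₃, y₄⟩ hxy
    simpa [j, Sum.elim_eq_iff, and_assoc] using hxy
  · simp [j, hE]

end Symplectic

/-- in the symplectic case, an isotropic subspace with invariants
`(r_U, r_W, a, b)` exists iff `b` is even, `2r_U + 2a + b ≤ dim U` and
`2r_W + 2a + b ≤ dim W`. -/
theorem stmt_15 (V : Type*) [AddCommGroup V] [Module ℝ V] [FiniteDimensional ℝ V]
    (B : LinearMap.BilinForm ℝ V)
    (hBalt : ∀ x : V, B x x = 0)
    (hBnd : ∀ x : V, (∀ y : V, B x y = 0) → x = 0)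
    (U W : Submodule ℝ V) (hUW : U ⊓ W = ⊥) (hUWtop : U ⊔ W = ⊤)
    (horth : ∀ u ∈ U, ∀ w ∈ W, B u w = 0)
    (rU rW a b : ℕ) :
    (∃ S : Submodule ℝ V, (∀ s ∈ S, ∀ s' ∈ S, B s s' = 0) ∧
      finrank ℝ (S ⊓ U : Submodule ℝ V) = rU ∧
      finrank ℝ (S ⊓ W : Submodule ℝ V) = rW ∧
      finrank ℝ (bilinRad B (projAlong W U S)) = rU + a ∧
      finrank ℝ (projAlong W U S) = rU + a + b ∧
      finrank ℝ S = rU + rW + a + b) ↔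
    (Even b ∧ 2 * rU + 2 * a + b ≤ finrank ℝ U ∧ 2 * rW + 2 * a + b ≤ finrank ℝ W) := by
  have hB : B.IsAlt := hBalt
  have hnd : B.Nondegenerate := hB.isRefl.nondegenerate_iff_separatingLeft.mpr hBnd
  have horth' : ∀ w ∈ W, ∀ u ∈ U, B w u = 0 := fun w hw u hu => by
    rw [← hB.neg_eq, horth u hu w hw, neg_zero]
  have hWU : W ⊓ U = ⊥ := inf_comm U W ▸ hUW
  have hWUtop : W ⊔ U = ⊤ := sup_comm U W ▸ hUWtop
  constructor
  · rintro ⟨S, hS, hSU, hSW, hrad, hproj, hdim⟩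
    have hrad_add := finrank_bilinRad_projAlong_add (S := S) hUW hUWtop horth
    rw [le_antisymm (inf_orthogonal_projAlong_le hS) (inf_orthogonal_projAlong_le hS),
      ← finrank_bilinRad_projAlong_add hWU hWUtop horth'] at hrad_add
    have hproj_add := finrank_projAlong_add_finrank_inf hWU hWUtop S
    have hU := finrank_add_finrank_bilinRad_le hnd hUW hUWtop horth
      (P := projAlong W U S) inf_le_right
    have hW := finrank_add_finrank_bilinRad_le hnd hWU hWUtop horth'
      (P := projAlong U W S) inf_le_right
    exact ⟨even_of_finrank_eq_finrank_bilinRad_add hB (by rw [hproj, hrad]), by omega, by omega⟩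
  · rintro ⟨⟨m, rfl⟩, hU, hW⟩
    have hUnd : ∀ x ∈ U, (∀ y ∈ U, B x y = 0) → x = 0 := fun x hx h => hBnd x fun y => by
      obtain ⟨u, hu, w, hw, rfl⟩ := Submodule.mem_sup.mp (hUWtop ▸ Submodule.mem_top : y ∈ U ⊔ W)
      rw [map_add, h u hu, horth x hx w hw, add_zero]
    have hWnd : ∀ x ∈ W, (∀ y ∈ W, (-B) x y = 0) → x = 0 := fun x hx h => hBnd x fun y => by
      obtain ⟨u, hu, w, hw, rfl⟩ := Submodule.mem_sup.mp (hUWtop ▸ Submodule.mem_top : y ∈ U ⊔ W)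
      rw [map_add, horth' x hx u hu, neg_eq_zero.mp (h w hw), add_zero]
    have hBneg : (-B).IsAlt := fun x => neg_eq_zero.mpr (hBalt x)
    obtain ⟨p, hpinj, hpU, hp⟩ := exists_presymplectic_embedding hB hUnd rU a m (by omega)
    obtain ⟨q, hqinj, hqW, hq⟩ := exists_presymplectic_embedding hBneg hWnd rW a m (by omega)
    let T := (Fin a → ℝ) × (Fin m → ℝ) × (Fin m → ℝ)
    let π : (Fin rU → ℝ) × (Fin rW → ℝ) × T →ₗ[ℝ] (Fin rU → ℝ) × T :=
      LinearMap.id.prodMap (LinearMap.snd ℝ _ _)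
    let ρ : (Fin rU → ℝ) × (Fin rW → ℝ) × T →ₗ[ℝ] (Fin rW → ℝ) × T := LinearMap.snd ℝ _ _
    have hπ : π.range = ⊤ := LinearMap.range_eq_top.mpr fun x => ⟨(x.1, 0, x.2), rfl⟩
    have hρ : ρ.range = ⊤ := LinearMap.range_eq_top.mpr fun x => ⟨(0, x), rfl⟩
    have hSp : projAlong W U (p ∘ₗ π + q ∘ₗ ρ).range = p.range := by
      rw [projAlong_range_add (p := p ∘ₗ π) (q := q ∘ₗ ρ) hUW (fun _ => hpU _) fun _ => hqW _,
        LinearMap.range_comp_of_range_eq_top _ hπ]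
    have hSq : projAlong U W (p ∘ₗ π + q ∘ₗ ρ).range = q.range := by
      rw [add_comm, projAlong_range_add (p := q ∘ₗ ρ) (q := p ∘ₗ π) hWU (fun _ => hqW _) fun _ => hpU _,
        LinearMap.range_comp_of_range_eq_top _ hρ]
    have hinj : Function.Injective (p ∘ₗ π + q ∘ₗ ρ) := by
      rw [injective_iff_map_eq_zero]
      intro x hx
      have hpq : p (π x) = -q (ρ x) := eq_neg_of_add_eq_zero_left hx
      have hmem : p (π x) ∈ U ⊓ W := ⟨hpU _, hpq ▸ W.neg_mem (hqW _)⟩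
      rw [hUW, Submodule.mem_bot] at hmem
      rw [hmem, zero_eq_neg] at hpq
      have h₁ := (map_eq_zero_iff p hpinj).mp hmem
      have h₂ := (map_eq_zero_iff q hqinj).mp hpq
      exact Prod.ext (congrArg (fun y => y.1) h₁ :) h₂
    have hrad : bilinRad B p.range =
        (p ∘ₗ LinearMap.id.prodMap (LinearMap.inl ℝ _ _)).range := by
      ext v
      constructor
      · rintro ⟨⟨⟨x, z, s, t⟩, rfl⟩, hv⟩
        have h : ∀ y : (Fin rU → ℝ) × T, y.2.2.1 ⬝ᵥ t - y.2.2.2 ⬝ᵥ s = 0 := fun y =>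
          (hp y (x, z, s, t)).symm.trans (hv _ ⟨y, rfl⟩)
        obtain rfl : t = 0 := by
          ext i
          simpa using h (0, 0, Pi.single i 1, 0)
        obtain rfl : s = 0 := by
          ext i
          simpa using h (0, 0, 0, Pi.single i 1)
        exact ⟨(x, z), rfl⟩
      · rintro ⟨⟨x, z⟩, rfl⟩
        refine ⟨⟨_, rfl⟩, ?_⟩
        rintro - ⟨y, rfl⟩
        exact (hp _ _).trans (by simp)
    have hdimS := LinearMap.finrank_range_of_inj hinj
    have hdimp := LinearMap.finrank_range_of_inj hpinj
    have hdimq := LinearMap.finrank_range_of_inj hqinj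
    have hdimr := LinearMap.finrank_range_of_inj
      (f := p ∘ₗ LinearMap.id.prodMap (LinearMap.inl ℝ (Fin a → ℝ) _))
      (hpinj.comp (Function.injective_id.prodMap LinearMap.inl_injective))
    have haddU := finrank_projAlong_add_finrank_inf hUW hUWtop (p ∘ₗ π + q ∘ₗ ρ).range
    have haddW := finrank_projAlong_add_finrank_inf hWU hWUtop (p ∘ₗ π + q ∘ₗ ρ).range
    simp only [T, finrank_prod, finrank_fin_fun] at hdimS hdimp hdimq hdimr
    rw [hSp] at haddU
    rw [hSq] at haddW
    refine ⟨(p ∘ₗ π + q ∘ₗ ρ).range, ?_, by omega, by omega, by rw [hSp, hrad, hdimr],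
      by rw [hSp]; omega, by omega⟩
    rintro - ⟨x, rfl⟩ - ⟨y, rfl⟩
    have h₁ := hp (π x) (π y)
    have h₂ := hq (ρ x) (ρ y)
    have h₃ : B (p (π x)) (q (ρ y)) = 0 := horth _ (hpU _) _ (hqW _)
    have h₄ : B (q (ρ x)) (p (π y)) = 0 := horth' _ (hqW _) _ (hpU _)
    have h₅ : B (p (π x)) (p (π y)) = -B (q (ρ x)) (q (ρ y)) := h₁.trans h₂.symm
    simp [h₃, h₄, h₅]
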